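/- The infinite series identity $\sum_{k=0}^{\infty}\Big(\frac{-1}{27}\Big)^k\frac{((1)_k)^2}{(7/6)_k\,(11/6)_k}\Big\{\frac{83+192k+112k^2}{64(1+4k)(3+4k)}H_{k}^{(2)}-\frac{(5+6k)(10+39k+48k^2+16k^3)}{(1+4k)^3(3+4k)^3}\Big\} = -\frac{15}{8}\beta(4)$ holds. -/

import Mathlib

open scoped BigOperators

/-- The shifted factorial (Pochhammer symbol) `(x)_n = x (x+1) ⋯ (x+n-1)`. -/
noncomputable def poch (x : ℝ) (n : ℕ) : ℝ := ∏ i ∈ Finset.range n, (x + i)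

/-- The harmonic numbers of order 2, `H_n^{(2)} = ∑_{j=1}^n 1/j²`. -/
noncomputable def H2 (n : ℕ) : ℝ := ∑ j ∈ Finset.range n, 1 / ((j : ℝ) + 1) ^ 2

/-- The Dirichlet beta value `β(4) = ∑_{k≥0} (-1)^k/(1+2k)⁴`. -/
noncomputable def beta4 : ℝ := ∑' k : ℕ, (-1) ^ k / (1 + 2 * (k : ℝ)) ^ 4

/-- The Catalan constant `G = ∑_{k≥0} (-1)^k/(1+2k)²`. -/
noncomputable def catalanG : ℝ := ∑' k : ℕ, (-1) ^ k / (1 + 2 * (k : ℝ)) ^ 2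

open Filter Topology

lemma poch_zero (x : ℝ) : poch x 0 = 1 := by simp [poch]

lemma poch_succ (x : ℝ) (n : ℕ) : poch x (n + 1) = poch x n * (x + n) := by
  simp [poch, Finset.prod_range_succ]

lemma poch_pos {x : ℝ} (hx : 0 < x) (n : ℕ) : 0 < poch x n :=
  Finset.prod_pos fun i _ => by positivity

lemma H2_succ (n : ℕ) : H2 (n + 1) = H2 n + 1 / ((n : ℝ) + 1) ^ 2 := by
  simp [H2, Finset.sum_range_succ]

lemma H2_nonneg (n : ℕ) : 0 ≤ H2 n := Finset.sum_nonneg fun i _ => by positivity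

lemma H2_le_two (n : ℕ) : H2 n ≤ 2 := by
  have key : ∀ n : ℕ, H2 (n + 1) ≤ 2 - 1 / ((n : ℝ) + 1) := by
    intro n
    induction n with
    | zero => norm_num [H2]
    | succ n ih =>
      rw [H2_succ]
      have h : 1 / ((n : ℝ) + 1) - 1 / ((n : ℝ) + 1 + 1) - 1 / ((n : ℝ) + 1 + 1) ^ 2
          = 1 / (((n : ℝ) + 1) * ((n : ℝ) + 1 + 1) ^ 2) := by
        field_simp
        ring
      have h' : 0 ≤ 1 / (((n : ℝ) + 1) * ((n : ℝ) + 1 + 1) ^ 2) := by positivity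
      push_cast
      linarith
  cases n with
  | zero => norm_num [H2]
  | succ n =>
    have h : 0 ≤ 1 / ((n : ℝ) + 1) := by positivity
    linarith [key n]

/-- The hypergeometric factor common to both members of the Wilf–Zeilberger pair. -/
noncomputable def wzBase (n j : ℕ) : ℝ :=
  (-1) ^ (n + j) * poch 1 n ^ 2 * poch (1 / 2) (n + j) / poch (3 / 2) (3 * n + j)

/-- The centre `j + 2n + 1/2` of the well-poised summand. -/
noncomputable def wzCentre (n j : ℕ) : ℝ := j + 2 * n + 1 / 2

/-- The summand of the Wilf–Zeilberger pair; at `n = 0` it is `16 (-1)^j / (2j+1)⁴`. -/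
noncomputable def wzF (n j : ℕ) : ℝ :=
  wzBase n j * (2 / wzCentre n j * (1 / wzCentre n j ^ 2 - H2 n))

/-- The rational factor of `wzG`, as a function of `n`, the centre `s` and `h = H2 n`. -/
noncomputable def wzRatio (n s h : ℝ) : ℝ :=
  ((s ^ 3 + (5 + 3 * n) * s ^ 2 + (10 + 13 * n + 4 * n ^ 2) * s + 2 * (n + 1) * (n + 2)) /
        (s * (s + 1)) * (1 / s ^ 2 + 1 / (s + 1) ^ 2 - h) -
      (3 * n + 2 * n ^ 2 + (1 + 8 * n + 4 * n ^ 2) * s + (2 + 2 * n) * s ^ 2 + 2 * s ^ 3) /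
        (s ^ 2 * (s + 1) ^ 2)) /
    ((s + n + 1) * (s + n + 2))

/-- The certificate companion of `wzF`. -/
noncomputable def wzG (n j : ℕ) : ℝ := wzBase n j * wzRatio n (wzCentre n j) (H2 n)

lemma wzCentre_pos (n j : ℕ) : 0 < wzCentre n j := by
  unfold wzCentre
  positivity

lemma wzBase_succ_right (n j : ℕ) :
    wzBase n (j + 1) = -wzBase n j * ((wzCentre n j - n) / (wzCentre n j + n + 1)) := by
  have h := (poch_pos (show (0 : ℝ) < 3 / 2 by norm_num) (3 * n + j)).ne'
  have h₂ : (j : ℝ) + 2 * n + 1 / 2 + n + 1 ≠ 0 := by positivity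
  have h₁ : (3 / 2 : ℝ) + (3 * n + j) ≠ 0 := by positivity
  unfold wzBase wzCentre
  rw [← add_assoc, ← add_assoc, poch_succ, poch_succ, pow_succ]
  push_cast
  rw [show (j : ℝ) + 2 * n + 1 / 2 + n + 1 = 3 / 2 + (3 * n + j) by ring]
  field_simp
  ring

lemma wzBase_succ_left (n j : ℕ) :
    wzBase (n + 1) j = -wzBase n j * ((n + 1) ^ 2 * (wzCentre n j - n) /
      ((wzCentre n j + n + 1) * (wzCentre n j + n + 2) * (wzCentre n j + n + 3))) := by
  have h := (poch_pos (show (0 : ℝ) < 3 / 2 by norm_num) (3 * n + j)).ne'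
  have h₁ : (3 / 2 : ℝ) + (3 * n + j) ≠ 0 := by positivity
  have h₂ : (3 / 2 : ℝ) + (3 * n + j + 1) ≠ 0 := by positivity
  have h₃ : (3 / 2 : ℝ) + (3 * n + j + 1 + 1) ≠ 0 := by positivity
  unfold wzBase wzCentre
  rw [show n + 1 + j = n + j + 1 by ring, show 3 * (n + 1) + j = 3 * n + j + 1 + 1 + 1 by ring,
    poch_succ, poch_succ, poch_succ, poch_succ, poch_succ, pow_succ]
  push_cast
  rw [show (j : ℝ) + 2 * n + 1 / 2 + n + 1 = 3 / 2 + (3 * n + j) by ring,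
    show (j : ℝ) + 2 * n + 1 / 2 + n + 2 = 3 / 2 + (3 * n + j + 1) by ring,
    show (j : ℝ) + 2 * n + 1 / 2 + n + 3 = 3 / 2 + (3 * n + j + 1 + 1) by ring]
  field_simp
  ring

lemma wzRatio_identity {n s : ℝ} (hn : 0 ≤ n) (hs : 0 < s) (h : ℝ) :
    -((n + 1) ^ 2 * (s - n) / ((s + n + 1) * (s + n + 2) * (s + n + 3))) *
          (2 / (s + 2) * (1 / (s + 2) ^ 2 - (h + 1 / (n + 1) ^ 2))) -
        2 / s * (1 / s ^ 2 - h) =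
      -((s - n) / (s + n + 1)) * wzRatio n (s + 1) h - wzRatio n s h := by
  unfold wzRatio
  have h₁ : s + n + 1 ≠ 0 := by positivity
  have h₂ : s + n + 2 ≠ 0 := by positivity
  have h₃ : s + n + 3 ≠ 0 := by positivity
  rw [show s + 1 + n + 1 = s + n + 2 by ring, show s + 1 + n + 2 = s + n + 3 by ring,
    show s + 1 + 1 = s + 2 by ring]
  field_simp
  ring

lemma wzF_sub_wzF (n j : ℕ) : wzF (n + 1) j - wzF n j = wzG n (j + 1) - wzG n j := by
  have key := wzRatio_identity n.cast_nonneg (wzCentre_pos n j) (H2 n)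
  have h₁ : wzCentre (n + 1) j = wzCentre n j + 2 := by
    unfold wzCentre; push_cast; ring
  have h₂ : wzCentre n (j + 1) = wzCentre n j + 1 := by
    unfold wzCentre; push_cast; ring
  unfold wzF wzG
  rw [h₁, h₂, wzBase_succ_left, wzBase_succ_right, H2_succ]
  linear_combination wzBase n j * key

lemma poch_half_eq (m : ℕ) : poch (1 / 2) m * (2 * m + 1) = poch (3 / 2) m := by
  induction m with
  | zero => simp [poch_zero]
  | succ m ih =>
    rw [poch_succ, poch_succ, ← ih]
    push_cast
    ring

lemma poch_one_sq_mul_le (n m : ℕ) (hm : n ≤ m) :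
    poch 1 n ^ 2 * poch (3 / 2) m ≤ poch (3 / 2) (m + 2 * n) := by
  induction n with
  | zero => simp [poch_zero]
  | succ n ih =>
    have hle := ih (by omega)
    have hnm : (n : ℝ) + 1 ≤ m := by exact_mod_cast hm
    rw [show m + 2 * (n + 1) = m + 2 * n + 1 + 1 by ring, poch_succ, poch_succ, poch_succ]
    push_cast
    have h0 := (poch_pos (show (0 : ℝ) < 3 / 2 by norm_num) (m + 2 * n)).le
    have hn : (0 : ℝ) ≤ n := n.cast_nonneg
    calc (poch 1 n * (1 + n)) ^ 2 * poch (3 / 2) m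
        = poch 1 n ^ 2 * poch (3 / 2) m * ((1 + n) * (1 + n)) := by ring
      _ ≤ poch (3 / 2) (m + 2 * n) * ((3 / 2 + (m + 2 * n)) * (3 / 2 + (m + 2 * n + 1))) := by
        gcongr <;> linarith
      _ = _ := by ring

lemma abs_wzBase_le (n j : ℕ) : |wzBase n j| ≤ 1 / (2 * j + 1) := by
  have hP := poch_pos (show (0 : ℝ) < 3 / 2 by norm_num) (3 * n + j)
  have hh := poch_pos (show (0 : ℝ) < 1 / 2 by norm_num) (n + j)
  have key := poch_one_sq_mul_le n (n + j) (by omega)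
  rw [show n + j + 2 * n = 3 * n + j by ring, ← poch_half_eq] at key
  unfold wzBase
  rw [abs_div, abs_mul, abs_mul, abs_pow, abs_neg, abs_one, one_pow, one_mul, abs_of_pos hP,
    abs_of_pos hh, abs_of_nonneg (sq_nonneg _), div_le_div_iff₀ hP (by positivity)]
  refine le_trans ?_ (key.trans (one_mul _).ge)
  rw [← mul_assoc]
  gcongr
  linarith [n.cast_nonneg (α := ℝ)]

lemma abs_wzRatio_le {n s h : ℝ} (hn : 0 ≤ n) (hs : 1 / 2 ≤ s) (hh : |h| ≤ 2) :
    |wzRatio n s h| ≤ 110 := by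
  obtain ⟨t, ht, rfl⟩ : ∃ t : ℝ, 0 ≤ t ∧ s = t + 1 / 2 := ⟨s - 1 / 2, by linarith, by ring⟩
  unfold wzRatio
  set s := t + 1 / 2 with hst
  have hs0 : 0 < s := by positivity
  set D := (s + n + 1) * (s + n + 2) with hD
  have hD0 : 0 < D := by positivity
  set Q := s ^ 3 + (5 + 3 * n) * s ^ 2 + (10 + 13 * n + 4 * n ^ 2) * s + 2 * (n + 1) * (n + 2)
    with hQ
  set R := 3 * n + 2 * n ^ 2 + (1 + 8 * n + 4 * n ^ 2) * s + (2 + 2 * n) * s ^ 2 + 2 * s ^ 3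
    with hR
  have hQ0 : 0 ≤ Q := by positivity
  have hR0 : 0 ≤ R := by positivity
  have hQle : Q / (s * (s + 1)) ≤ 10 * D := by
    rw [div_le_iff₀ (by positivity), ← sub_nonneg, hQ, hD, hst]
    ring_nf
    positivity
  have hRle : R / (s ^ 2 * (s + 1) ^ 2) ≤ 10 * D := by
    rw [div_le_iff₀ (by positivity), ← sub_nonneg, hR, hD, hst]
    ring_nf
    positivity
  have hinv : 1 / s ^ 2 ≤ 4 := by
    rw [div_le_iff₀ (by positivity)]
    nlinarith
  have hinv' : 1 / (s + 1) ^ 2 ≤ 4 := by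
    rw [div_le_iff₀ (by positivity)]
    nlinarith
  have hbr : |1 / s ^ 2 + 1 / (s + 1) ^ 2 - h| ≤ 10 := by
    have h₁ : 0 ≤ 1 / s ^ 2 := by positivity
    have h₂ : 0 ≤ 1 / (s + 1) ^ 2 := by positivity
    have := abs_le.1 hh
    exact abs_le.2 ⟨by linarith, by linarith⟩
  rw [abs_div, abs_of_pos hD0, div_le_iff₀ hD0]
  refine (abs_sub _ _).trans ?_
  rw [abs_mul, abs_of_nonneg (show 0 ≤ Q / (s * (s + 1)) by positivity),
    abs_of_nonneg (show 0 ≤ R / (s ^ 2 * (s + 1) ^ 2) by positivity)]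
  calc Q / (s * (s + 1)) * |1 / s ^ 2 + 1 / (s + 1) ^ 2 - h| + R / (s ^ 2 * (s + 1) ^ 2)
      ≤ 10 * D * 10 + 10 * D := by gcongr
    _ = 110 * D := by ring

lemma tendsto_wzG (n : ℕ) : Tendsto (wzG n) atTop (𝓝 0) := by
  have hlim : Tendsto (fun j : ℕ => 110 * (1 / ((j : ℝ) + 1))) atTop (𝓝 0) := by
    simpa using tendsto_one_div_add_atTop_nhds_zero_nat.const_mul (110 : ℝ)
  refine squeeze_zero_norm (fun j => ?_) hlim
  have hs : 1 / 2 ≤ wzCentre n j := by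
    unfold wzCentre
    linarith [n.cast_nonneg (α := ℝ), j.cast_nonneg (α := ℝ)]
  have hr := abs_wzRatio_le n.cast_nonneg hs
    (abs_le.2 ⟨by linarith [H2_nonneg n], H2_le_two n⟩)
  have hb : |wzBase n j| ≤ 1 / ((j : ℝ) + 1) := by
    refine (abs_wzBase_le n j).trans ?_
    gcongr
    linarith [j.cast_nonneg (α := ℝ)]
  rw [wzG, Real.norm_eq_abs, abs_mul, mul_comm]
  gcongr

lemma abs_wzF_le (n j : ℕ) : |wzF n j| ≤ 1 / (2 * j + 1) * (12 / wzCentre n j) := by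
  have hs : 1 / 2 ≤ wzCentre n j := by
    unfold wzCentre
    linarith [n.cast_nonneg (α := ℝ), j.cast_nonneg (α := ℝ)]
  have hs0 := wzCentre_pos n j
  have hinv : 1 / wzCentre n j ^ 2 ≤ 4 := by
    rw [div_le_iff₀ (by positivity)]
    nlinarith
  have hbr : |1 / wzCentre n j ^ 2 - H2 n| ≤ 6 := by
    have h₁ : 0 ≤ 1 / wzCentre n j ^ 2 := by positivity
    exact abs_le.2 ⟨by linarith [H2_le_two n], by linarith [H2_nonneg n]⟩
  rw [wzF, abs_mul, abs_mul, abs_of_pos (show 0 < 2 / wzCentre n j by positivity)]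
  calc |wzBase n j| * (2 / wzCentre n j * |1 / wzCentre n j ^ 2 - H2 n|)
      ≤ 1 / (2 * j + 1) * (2 / wzCentre n j * 6) := by
        gcongr
        exact abs_wzBase_le n j
    _ = 1 / (2 * j + 1) * (12 / wzCentre n j) := by ring

lemma norm_wzF_le_of_index (n j : ℕ) : ‖wzF n j‖ ≤ 24 * (1 / ((j : ℝ) + 1) ^ 2) := by
  refine (abs_wzF_le n j).trans ?_
  have hj : (0 : ℝ) ≤ j := j.cast_nonneg
  calc 1 / (2 * j + 1) * (12 / wzCentre n j) ≤ 1 / ((j : ℝ) + 1) * (12 / (((j : ℝ) + 1) / 2)) := by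
        unfold wzCentre
        gcongr <;> linarith [n.cast_nonneg (α := ℝ)]
    _ = 24 * (1 / ((j : ℝ) + 1) ^ 2) := by field_simp; norm_num

lemma norm_wzF_le_of_level (n j : ℕ) : ‖wzF n j‖ ≤ 24 * (1 / ((n : ℝ) + 1)) := by
  refine (abs_wzF_le n j).trans ?_
  have hj : (0 : ℝ) ≤ j := j.cast_nonneg
  have hn : (0 : ℝ) ≤ n := n.cast_nonneg
  calc 1 / (2 * j + 1) * (12 / wzCentre n j) ≤ 1 / 1 * (12 / (((n : ℝ) + 1) / 2)) := by
        unfold wzCentre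
        gcongr <;> linarith
    _ = 24 * (1 / ((n : ℝ) + 1)) := by field_simp; norm_num

lemma summable_wzF_bound : Summable fun j : ℕ => 24 * (1 / ((j : ℝ) + 1) ^ 2) := by
  have h := (summable_nat_add_iff 1).2 (Real.summable_one_div_nat_pow.2 one_lt_two)
  simpa using h.mul_left (24 : ℝ)

lemma summable_wzF (n : ℕ) : Summable (wzF n) :=
  summable_wzF_bound.of_norm_bounded (norm_wzF_le_of_index n)

lemma tsum_wzF_succ (n : ℕ) : ∑' j, wzF (n + 1) j = ∑' j, wzF n j - wzG n 0 := by
  have h := ((summable_wzF (n + 1)).sub (summable_wzF n)).hasSum.tendsto_sum_nat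
  simp only [wzF_sub_wzF, Finset.sum_range_sub] at h
  have h' := tendsto_nhds_unique h ((tendsto_wzG n).sub_const _)
  simp only [← wzF_sub_wzF] at h'
  rw [(summable_wzF (n + 1)).tsum_sub (summable_wzF n)] at h'
  linarith

lemma sum_wzG (N : ℕ) : ∑ n ∈ Finset.range N, wzG n 0 = ∑' j, wzF 0 j - ∑' j, wzF N j := by
  induction N with
  | zero => simp
  | succ N ih => rw [Finset.sum_range_succ, ih, tsum_wzF_succ]; ring

lemma tendsto_tsum_wzF : Tendsto (fun n => ∑' j, wzF n j) atTop (𝓝 0) := by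
  have hpt : ∀ j, Tendsto (fun n => wzF n j) atTop (𝓝 0) := fun j => by
    refine squeeze_zero_norm (norm_wzF_le_of_level · j) ?_
    simpa using tendsto_one_div_add_atTop_nhds_zero_nat.const_mul (24 : ℝ)
  simpa using tendsto_tsum_of_dominated_convergence summable_wzF_bound hpt
    (Eventually.of_forall fun n j => norm_wzF_le_of_index n j)

lemma tsum_wzF_zero : ∑' j, wzF 0 j = 16 * beta4 := by
  rw [beta4, ← tsum_mul_left]
  congr 1
  ext j
  have hP := (poch_pos (show (0 : ℝ) < 1 / 2 by norm_num) j).ne'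
  have hj : (1 : ℝ) + 2 * j ≠ 0 := by positivity
  simp only [wzF, wzBase, wzCentre, H2, Finset.range_zero, Finset.sum_empty, poch_zero, zero_add,
    mul_zero, Nat.cast_zero, ← poch_half_eq]
  rw [show (j : ℝ) + 0 + 1 / 2 = (1 + 2 * j) / 2 by ring, show 2 * (j : ℝ) + 1 = 1 + 2 * j by ring]
  field_simp
  ring

lemma poch_three_halves_triple (n : ℕ) :
    poch (3 / 2) (3 * n + 2) =
      15 / 4 * 27 ^ n * poch (7 / 6) n * poch (11 / 6) n * poch (1 / 2) n * (2 * n + 1) := by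
  induction n with
  | zero => norm_num [poch]
  | succ n ih =>
    rw [show 3 * (n + 1) + 2 = 3 * n + 2 + 1 + 1 + 1 by ring, poch_succ, poch_succ, poch_succ, ih,
      poch_succ, poch_succ, poch_succ]
    push_cast
    ring

lemma wzG_zero_right (k : ℕ) :
    (-1 / 27 : ℝ) ^ k * (poch 1 k ^ 2 / (poch (7 / 6) k * poch (11 / 6) k)) *
      ((83 + 192 * (k : ℝ) + 112 * (k : ℝ) ^ 2) /
          (64 * (1 + 4 * (k : ℝ)) * (3 + 4 * (k : ℝ))) * H2 k -
        (5 + 6 * (k : ℝ)) * (10 + 39 * (k : ℝ) + 48 * (k : ℝ) ^ 2 + 16 * (k : ℝ) ^ 3) /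
          ((1 + 4 * (k : ℝ)) ^ 3 * (3 + 4 * (k : ℝ)) ^ 3)) = -(15 / 128) * wzG k 0 := by
  have h₁ := (poch_pos (show (0 : ℝ) < 7 / 6 by norm_num) k).ne'
  have h₂ := (poch_pos (show (0 : ℝ) < 11 / 6 by norm_num) k).ne'
  have h₃ := (poch_pos (show (0 : ℝ) < 1 / 2 by norm_num) k).ne'
  have h₄ := (poch_pos (show (0 : ℝ) < 3 / 2 by norm_num) (3 * k)).ne'
  have h₅ : (2 : ℝ) * k + 1 ≠ 0 := by positivity
  have h₆ : (1 : ℝ) + 4 * k ≠ 0 := by positivity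
  have h₇ : (3 : ℝ) + 4 * k ≠ 0 := by positivity
  have h₈ : (5 : ℝ) + 6 * k ≠ 0 := by positivity
  have hbase : wzBase k 0 = (-1 / 27 : ℝ) ^ k *
      (poch 1 k ^ 2 / (poch (7 / 6) k * poch (11 / 6) k)) * ((5 + 6 * k) / 5) := by
    have h := poch_three_halves_triple k
    rw [poch_succ, poch_succ] at h
    push_cast at h
    have h' : poch (3 / 2) (3 * k) =
        5 * 27 ^ k * poch (7 / 6) k * poch (11 / 6) k * poch (1 / 2) k / (5 + 6 * k) := by
      rw [eq_div_iff h₈]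
      apply mul_right_cancel₀ h₅
      linear_combination 4 / 3 * h
    rw [wzBase, add_zero, add_zero, h', div_pow]
    field_simp
  rw [wzG, hbase, wzRatio, wzCentre,
    show ((0 : ℕ) : ℝ) + 2 * k + 1 / 2 = (1 + 4 * k) / 2 by push_cast; ring,
    show ((1 : ℝ) + 4 * k) / 2 + 1 = (3 + 4 * k) / 2 by ring,
    show ((1 : ℝ) + 4 * k) / 2 + k + 1 = 3 * (2 * k + 1) / 2 by ring,
    show ((1 : ℝ) + 4 * k) / 2 + k + 2 = (5 + 6 * k) / 2 by ring]
  field_simp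
  ring

lemma abs_wzBase_zero_right_le (n : ℕ) : |wzBase n 0| ≤ (1 / 2) ^ n := by
  induction n with
  | zero => simp [wzBase, poch_zero]
  | succ n ih =>
    have hfac : 0 ≤ ((n : ℝ) + 1) ^ 2 * (wzCentre n 0 - n) /
        ((wzCentre n 0 + n + 1) * (wzCentre n 0 + n + 2) * (wzCentre n 0 + n + 3)) ∧
        ((n : ℝ) + 1) ^ 2 * (wzCentre n 0 - n) /
        ((wzCentre n 0 + n + 1) * (wzCentre n 0 + n + 2) * (wzCentre n 0 + n + 3)) ≤ 1 / 2 := by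
      have hc : wzCentre n 0 = n + (n + 1 / 2) := by unfold wzCentre; push_cast; ring
      rw [hc, add_sub_cancel_left]
      refine ⟨by positivity, ?_⟩
      rw [div_le_iff₀ (by positivity), ← sub_nonneg]
      ring_nf
      positivity
    rw [wzBase_succ_left, abs_mul, abs_neg, abs_of_nonneg hfac.1, pow_succ]
    exact mul_le_mul ih hfac.2 hfac.1 (pow_nonneg one_half_pos.le n)

lemma summable_wzG_zero_right : Summable fun n => wzG n 0 := by
  refine ((summable_geometric_two).mul_right 110).of_norm_bounded fun n => ?_
  have hs : 1 / 2 ≤ wzCentre n 0 := by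
    unfold wzCentre
    linarith [n.cast_nonneg (α := ℝ), (0 : ℕ).cast_nonneg (α := ℝ)]
  rw [wzG, Real.norm_eq_abs, abs_mul]
  gcongr
  · exact abs_wzBase_zero_right_le n
  · exact abs_wzRatio_le n.cast_nonneg hs (abs_le.2 ⟨by linarith [H2_nonneg n], H2_le_two n⟩)

lemma tsum_wzG_zero_right : ∑' n, wzG n 0 = 16 * beta4 := by
  have h := tendsto_tsum_wzF.const_sub (∑' j, wzF 0 j)
  rw [sub_zero, tsum_wzF_zero] at h
  refine tendsto_nhds_unique summable_wzG_zero_right.hasSum.tendsto_sum_nat ?_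
  simpa only [sum_wzG, tsum_wzF_zero] using h

theorem stmt5 :
    (∑' k : ℕ, (-1/27 : ℝ) ^ k * (poch 1 k ^ 2 / (poch (7/6) k * poch (11/6) k)) *
      ((83 + 192 * (k : ℝ) + 112 * (k : ℝ) ^ 2) /
          (64 * (1 + 4 * (k : ℝ)) * (3 + 4 * (k : ℝ))) * H2 k -
        (5 + 6 * (k : ℝ)) * (10 + 39 * (k : ℝ) + 48 * (k : ℝ) ^ 2 + 16 * (k : ℝ) ^ 3) /
          ((1 + 4 * (k : ℝ)) ^ 3 * (3 + 4 * (k : ℝ)) ^ 3))) = -(15/8) * beta4 := by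
  simp only [wzG_zero_right]
  rw [tsum_mul_left, tsum_wzG_zero_right]
  ring
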